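/- arXiv:1710.08971 — 8 statements merged into one kernel-verified Lean document; each statement's English description precedes it below -/
import Mathlib

section
/- Let J be a many-sorted closure operator on an S-sorted set A. Then J is 0-ary (i.e., J = J_{≤0}^ω) if, and only if, for every X ⊆ A, J(X) = X ∪ J(∅^S), where ∅^S is the S-sorted set all of whose coordinates are empty. -/
universe u v w

namespace ManySorted

variable {S : Type u}

/-- The delta of Kronecker `δ^{t,x}`: the S-sorted set whose `t`-th coordinate is `{x}`
and whose other coordinates are empty. -/
def delta {α : S → Type v} (t : S) (x : α t) : ∀ s, Set (α s) :=
  fun s => {y | (⟨s, y⟩ : Σ s, α s) = ⟨t, x⟩}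

/-- The cardinal of an S-sorted set: the cardinal of its coproduct. -/
def scard {α : S → Type v} (X : ∀ s, Set (α s)) : Cardinal.{max u v} :=
  Cardinal.mk (Σ s, ↥(X s))

/-- The support of an S-sorted set. -/
def supp {α : S → Type v} (X : ∀ s, Set (α s)) : Set S := {s | (X s).Nonempty}

section Closure

variable {α : S → Type v}

/-- `J` is a many-sorted closure operator: extensive, isotone and idempotent. -/
def IsClosureOp (J : (∀ s, Set (α s)) → (∀ s, Set (α s))) : Prop :=
  (∀ X s, X s ⊆ J X s) ∧
  (∀ X Y, (∀ s, X s ⊆ Y s) → ∀ s, J X s ⊆ J Y s) ∧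
  (∀ X, J (J X) = J X)

/-- The operator `J_{≤n}`. -/
def Jle (J : (∀ s, Set (α s)) → (∀ s, Set (α s))) (n : ℕ)
    (X : ∀ s, Set (α s)) : ∀ s, Set (α s) :=
  fun s => ⋃ (Y : ∀ s, Set (α s)) (_ : (∀ t, Y t ⊆ X t) ∧ scard Y ≤ (n : Cardinal)), J Y s

/-- The iterates `J_{≤n}^m`. -/
def JleIter (J : (∀ s, Set (α s)) → (∀ s, Set (α s))) (n : ℕ) :
    ℕ → (∀ s, Set (α s)) → (∀ s, Set (α s))
  | 0 => fun X => X
  | k + 1 => fun X => Jle J n (JleIter J n k X)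

/-- The operator `J_{≤n}^ω`. -/
def Jlomega (J : (∀ s, Set (α s)) → (∀ s, Set (α s))) (n : ℕ)
    (X : ∀ s, Set (α s)) : ∀ s, Set (α s) :=
  fun s => ⋃ m : ℕ, JleIter J n m X s

/-- `J` is an `n`-ary many-sorted closure operator if `J = J_{≤n}^ω`. -/
def IsNary (n : ℕ) (J : (∀ s, Set (α s)) → (∀ s, Set (α s))) : Prop :=
  J = Jlomega J n

/-- `J` is algebraic. -/
def Algebraic (J : (∀ s, Set (α s)) → (∀ s, Set (α s))) : Prop :=
  ∀ X, J X = fun s =>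
    ⋃ (K : ∀ s, Set (α s)) (_ : (∀ t, K t ⊆ X t) ∧ scard K < Cardinal.aleph0), J K s

/-- `J` is uniform. -/
def Uniform (J : (∀ s, Set (α s)) → (∀ s, Set (α s))) : Prop :=
  ∀ X Y, supp X = supp Y → supp (J X) = supp (J Y)

/-- `X` is irredundant (independent) with respect to `J`. -/
def Irredundant (J : (∀ s, Set (α s)) → (∀ s, Set (α s)))
    (X : ∀ s, Set (α s)) : Prop :=
  ∀ s, ∀ x ∈ X s, x ∉ J (fun t => X t \ delta s x t) s

/-- `X` is a basis (generator) with respect to `J`. -/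
def IsBasis (J : (∀ s, Set (α s)) → (∀ s, Set (α s)))
    (X : ∀ s, Set (α s)) : Prop :=
  ∀ s, J X s = Set.univ

/-- `IrB (A, J)`: the set of natural numbers that are the cardinal of an irredundant basis. -/
def IrB (J : (∀ s, Set (α s)) → (∀ s, Set (α s))) : Set ℕ :=
  {n | ∃ X : ∀ s, Set (α s), Irredundant J X ∧ IsBasis J X ∧ scard X = (n : Cardinal)}

end Closure

section Algebra

variable {α : S → Type v}

/-- `X` is closed under all the operations of the algebra `(A, F)`. -/
def Closed (Sig : List S → S → Type w)
    (F : ∀ w s, Sig w s → ((∀ i : Fin w.length, α (w.get i)) → α s))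
    (X : ∀ s, Set (α s)) : Prop :=
  ∀ (w : List S) (s : S) (σ : Sig w s) (a : ∀ i : Fin w.length, α (w.get i)),
    (∀ i, a i ∈ X (w.get i)) → F w s σ a ∈ X s

/-- The subalgebra generating operator `Sg`. -/
def Sg (Sig : List S → S → Type w)
    (F : ∀ w s, Sig w s → ((∀ i : Fin w.length, α (w.get i)) → α s))
    (X : ∀ s, Set (α s)) : ∀ s, Set (α s) :=
  fun s => ⋂ (C : ∀ s, Set (α s)) (_ : Closed Sig F C ∧ ∀ t, X t ⊆ C t), C s

/-- The one-step operator `E_𝐀`. -/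
def Estep (Sig : List S → S → Type w)
    (F : ∀ w s, Sig w s → ((∀ i : Fin w.length, α (w.get i)) → α s))
    (X : ∀ s, Set (α s)) : ∀ s, Set (α s) :=
  fun s => X s ∪ {y | ∃ (w : List S) (σ : Sig w s) (a : ∀ i : Fin w.length, α (w.get i)),
    (∀ i, a i ∈ X (w.get i)) ∧ F w s σ a = y}

/-- The iterates `E_𝐀^n`. -/
def Eiter (Sig : List S → S → Type w)
    (F : ∀ w s, Sig w s → ((∀ i : Fin w.length, α (w.get i)) → α s)) :
    ℕ → (∀ s, Set (α s)) → (∀ s, Set (α s))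
  | 0 => fun X => X
  | k + 1 => fun X => Estep Sig F (Eiter Sig F k X)

/-- `E_𝐀^ω`. -/
def Eomega (Sig : List S → S → Type w)
    (F : ∀ w s, Sig w s → ((∀ i : Fin w.length, α (w.get i)) → α s))
    (X : ∀ s, Set (α s)) : ∀ s, Set (α s) :=
  fun s => ⋃ n : ℕ, Eiter Sig F n X s

end Algebra

end ManySorted

namespace ManySorted

variable {S : Type u} {α : S → Type v}

theorem scard_le_zero_iff (X : ∀ s, Set (α s)) :
    scard X ≤ ((0 : ℕ) : Cardinal) ↔ X = fun _ => ∅ := by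
  rw [scard, Nat.cast_zero, nonpos_iff_eq_zero, Cardinal.mk_eq_zero_iff, isEmpty_sigma]
  simp only [Set.isEmpty_coe_sort, funext_iff]

theorem Jle_zero (J : (∀ s, Set (α s)) → (∀ s, Set (α s))) (X : ∀ s, Set (α s)) :
    Jle J 0 X = J (fun _ => ∅) := by
  ext s x
  simp only [Jle, scard_le_zero_iff, Set.mem_iUnion, exists_prop]
  constructor
  · rintro ⟨_, ⟨_, rfl⟩, hx⟩
    exact hx
  · exact fun hx => ⟨_, ⟨fun _ => Set.empty_subset _, rfl⟩, hx⟩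

theorem Jlomega_zero (J : (∀ s, Set (α s)) → (∀ s, Set (α s))) (X : ∀ s, Set (α s)) :
    Jlomega J 0 X = fun s => X s ∪ J (fun _ => ∅) s := by
  ext s x
  simp only [Jlomega, Set.mem_iUnion, Set.mem_union]
  constructor
  · rintro ⟨_ | m, hx⟩
    · exact Or.inl hx
    · simp only [JleIter, Jle_zero] at hx
      exact Or.inr hx
  · rintro (hx | hx)
    · exact ⟨0, hx⟩
    · refine ⟨1, ?_⟩
      simpa only [JleIter, Jle_zero] using hx

end ManySorted

open ManySorted in
/-- `J` is `0`-ary iff `J(X) = X ∪ J(∅^S)` for every `X`. -/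
theorem statement_2 {S : Type u} {α : S → Type v}
    (J : (∀ s, Set (α s)) → (∀ s, Set (α s))) (hJ : IsClosureOp J) :
    IsNary 0 J ↔
      ∀ X : ∀ s, Set (α s), J X = fun s => X s ∪ J (fun _ => (∅ : Set _)) s := by
  simp only [IsNary, funext_iff (f := J), Jlomega_zero]
end

section
/- Let J be a many-sorted closure operator on an S-sorted set A. Then J is 1-ary (i.e., J = J_{≤1}^ω) if, and only if, for every X ⊆ A, J(X) = J(∅^S) ∪ ⋃_{s ∈ S, x ∈ X_s} J(δ^{s,x}). -/
universe u v w

namespace ManySorted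

variable {S : Type u} {α : S → Type v}

lemma delta_subset_iff {X : ∀ s, Set (α s)} {t : S} {x : α t} :
    (∀ s, delta t x s ⊆ X s) ↔ x ∈ X t := by
  refine ⟨fun h => h t rfl, fun h s y hy => ?_⟩
  cases hy
  exact h

lemma scard_empty : scard (fun s => (∅ : Set (α s))) = 0 :=
  Cardinal.mk_eq_zero_iff.2 ⟨fun a => a.2.2⟩

lemma scard_delta_le_one (t : S) (x : α t) : scard (delta t x) ≤ 1 := by
  refine Cardinal.le_one_iff_subsingleton.2 ⟨?_⟩
  rintro ⟨a, b, hb⟩ ⟨c, d, hd⟩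
  cases hb
  cases hd
  rfl

lemma eq_empty_or_eq_delta_of_scard_le_one {Y : ∀ s, Set (α s)} (h : scard Y ≤ 1) :
    Y = (fun _ => ∅) ∨ ∃ (t : S) (y : α t), Y = delta t y := by
  have hsub := Cardinal.le_one_iff_subsingleton.1 h
  by_cases hne : ∃ t, (Y t).Nonempty
  · obtain ⟨t, y, hy⟩ := hne
    refine Or.inr ⟨t, y, ?_⟩
    funext s
    refine Set.Subset.antisymm (fun z hz => ?_) (delta_subset_iff.2 hy s)
    exact congrArg (fun a : Σ s, Y s => (⟨a.1, a.2.1⟩ : Σ s, α s))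
      (hsub.elim ⟨s, z, hz⟩ ⟨t, y, hy⟩)
  · left
    funext s
    exact Set.not_nonempty_iff_eq_empty.1 fun hs => hne ⟨s, hs⟩

/-- A single application of `J_{≤1}` is `J(∅^S)` together with the closures of the points. -/
lemma Jle_one (J : (∀ s, Set (α s)) → (∀ s, Set (α s))) (X : ∀ s, Set (α s)) :
    Jle J 1 X = fun s => J (fun _ => (∅ : Set _)) s ∪
      ⋃ (t : S) (x : α t) (_ : x ∈ X t), J (delta t x) s := by
  funext s
  ext z
  simp only [Jle, Set.mem_iUnion, Set.mem_union, exists_prop, Nat.cast_one]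
  constructor
  · rintro ⟨Y, ⟨hYX, hY⟩, hz⟩
    obtain rfl | ⟨t, y, rfl⟩ := eq_empty_or_eq_delta_of_scard_le_one hY
    · exact Or.inl hz
    · exact Or.inr ⟨t, y, delta_subset_iff.1 hYX, hz⟩
  · rintro (hz | ⟨t, x, hx, hz⟩)
    · exact ⟨_, ⟨fun _ => Set.empty_subset _, scard_empty.trans_le zero_le_one⟩, hz⟩
    · exact ⟨_, ⟨delta_subset_iff.2 hx, scard_delta_le_one t x⟩, hz⟩

namespace IsClosureOp

variable {J : (∀ s, Set (α s)) → (∀ s, Set (α s))}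

lemma subset_of_subset (hJ : IsClosureOp J) {X Y : ∀ s, Set (α s)}
    (h : ∀ s, X s ⊆ J Y s) (s : S) : J X s ⊆ J Y s :=
  (hJ.2.1 X (J Y) h s).trans (congrFun (hJ.2.2 Y) s).subset

lemma Jle_one_Jle_one_subset (hJ : IsClosureOp J) (X : ∀ s, Set (α s)) (s : S) :
    Jle J 1 (Jle J 1 X) s ⊆ Jle J 1 X s := by
  rw [Jle_one J (Jle J 1 X)]
  refine Set.union_subset ?_ ?_
  · rw [Jle_one]
    exact Set.subset_union_left
  · refine Set.iUnion₂_subset fun t y => Set.iUnion_subset fun hy => ?_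
    obtain ⟨Z, hZ, hyZ⟩ := Set.mem_iUnion₂.1 hy
    exact (hJ.subset_of_subset (delta_subset_iff.2 hyZ) s).trans
      (Set.subset_iUnion₂_of_subset Z hZ subset_rfl)

lemma subset_Jle_one (hJ : IsClosureOp J) (X : ∀ s, Set (α s)) (s : S) :
    X s ⊆ Jle J 1 X s := by
  intro x hx
  exact Set.mem_iUnion₂.2 ⟨delta s x,
    ⟨delta_subset_iff.2 hx, by simpa using scard_delta_le_one s x⟩, hJ.1 _ s rfl⟩

lemma Jlomega_one (hJ : IsClosureOp J) (X : ∀ s, Set (α s)) : Jlomega J 1 X = Jle J 1 X := by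
  have hiter : ∀ m s, JleIter J 1 m X s ⊆ Jle J 1 X s := by
    intro m
    induction m with
    | zero => exact hJ.subset_Jle_one X
    | succ m ih =>
      exact fun s => (Set.iUnion₂_subset fun Y hY => Set.subset_iUnion₂_of_subset Y
        ⟨fun t => (hY.1 t).trans (ih t), hY.2⟩ subset_rfl).trans (hJ.Jle_one_Jle_one_subset X s)
  funext s
  exact Set.Subset.antisymm (Set.iUnion_subset fun m => hiter m s)
    (Set.subset_iUnion (fun m => JleIter J 1 m X s) 1)

end IsClosureOp

end ManySorted

open ManySorted in
/-- `J` is `1`-ary iff `J(X) = J(∅^S) ∪ ⋃_{s ∈ S, x ∈ X_s} J(δ^{s,x})` for every `X`. -/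
theorem statement_3 {S : Type u} {α : S → Type v}
    (J : (∀ s, Set (α s)) → (∀ s, Set (α s))) (hJ : IsClosureOp J) :
    IsNary 1 J ↔
      ∀ X : ∀ s, Set (α s), J X = fun s =>
        J (fun _ => (∅ : Set _)) s ∪
          ⋃ (t : S) (x : α t) (_ : x ∈ X t), J (delta t x) s := by
  simp only [IsNary, funext_iff (f := J), hJ.Jlomega_one, Jle_one]
end

section
/- For a natural number n ≥ 1, an S-sorted set A, and a many-sorted closure operator J on A, the operator J_{≤n}^ω is the greatest n-ary many-sorted closure operator on A that is smaller than or equal to J; that is: J_{≤n}^ω is a many-sorted closure operator on A, it is n-ary, J_{≤n}^ω ≤ J, and for every n-ary many-sorted closure operator K on A with K ≤ J one has K ≤ J_{≤n}^ω. -/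
universe u v w

namespace ManySorted

variable {S : Type u} {α : S → Type v}

theorem scard_delta (t : S) (x : α t) : scard (delta t x) = 1 := by
  have : Unique (Σ s, ↥(delta t x s)) :=
    { default := ⟨t, x, rfl⟩
      uniq := by
        rintro ⟨s, y, hy⟩
        cases hy
        rfl }
  exact Cardinal.mk_eq_one _

theorem apply_le_Jle_of_scard_le {J : (∀ s, Set (α s)) → (∀ s, Set (α s))} {n : ℕ}
    {X Y : ∀ s, Set (α s)} (hYX : Y ≤ X) (hY : scard Y ≤ n) : J Y ≤ Jle J n X :=
  fun _ _ hx => Set.mem_iUnion₂.2 ⟨Y, ⟨hYX, hY⟩, hx⟩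

theorem Jle_le_iff {J : (∀ s, Set (α s)) → (∀ s, Set (α s))} {n : ℕ}
    {X Z : ∀ s, Set (α s)} :
    Jle J n X ≤ Z ↔ ∀ Y, Y ≤ X → scard Y ≤ n → J Y ≤ Z := by
  refine ⟨fun h Y hYX hY => (apply_le_Jle_of_scard_le hYX hY).trans h, fun h s x hx => ?_⟩
  obtain ⟨Y, ⟨hYX, hY⟩, hxY⟩ := Set.mem_iUnion₂.1 hx
  exact h Y hYX hY s hxY

theorem Jle_mono (J : (∀ s, Set (α s)) → (∀ s, Set (α s))) (n : ℕ) : Monotone (Jle J n) :=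
  fun _ _ hXZ => Jle_le_iff.2 fun _ hYX hY => apply_le_Jle_of_scard_le (hYX.trans hXZ) hY

theorem le_Jle {J : (∀ s, Set (α s)) → (∀ s, Set (α s))} (hJ : ∀ X, X ≤ J X) {n : ℕ}
    (hn : 1 ≤ n) (X : ∀ s, Set (α s)) : X ≤ Jle J n X := by
  intro t x hx
  refine apply_le_Jle_of_scard_le (Y := delta t x) ?_ ?_ t (hJ _ t rfl)
  · intro s y hy
    cases hy
    exact hx
  · rw [scard_delta]
    exact_mod_cast hn

theorem le_Jlomega (J : (∀ s, Set (α s)) → (∀ s, Set (α s))) (n : ℕ)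
    (X : ∀ s, Set (α s)) : X ≤ Jlomega J n X :=
  fun _ _ hx => Set.mem_iUnion.2 ⟨0, hx⟩

/-- `J_{≤n}^ω(X)` lies below every `J_{≤n}`-closed set containing `X`. -/
theorem Jlomega_le {J : (∀ s, Set (α s)) → (∀ s, Set (α s))} {n : ℕ}
    {X Z : ∀ s, Set (α s)} (hXZ : X ≤ Z) (hZ : Jle J n Z ≤ Z) : Jlomega J n X ≤ Z := by
  have h (m : ℕ) : JleIter J n m X ≤ Z := by
    induction m with
    | zero => exact hXZ
    | succ m ih => exact (Jle_mono J n ih).trans hZ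
  exact fun s => Set.iUnion_subset fun m => h m s

/-- `J_{≤n}^ω(X)` is `J_{≤n}`-closed. -/
theorem Jle_Jlomega_le {J : (∀ s, Set (α s)) → (∀ s, Set (α s))} (hJ : ∀ X, X ≤ J X) {n : ℕ}
    (hn : 1 ≤ n) (X : ∀ s, Set (α s)) : Jle J n (Jlomega J n X) ≤ Jlomega J n X := by
  have hmono : Monotone fun m => JleIter J n m X :=
    monotone_nat_of_le_succ fun m => le_Jle hJ hn _
  refine Jle_le_iff.2 fun Y hYX hY s x hx => ?_
  have : Finite (Σ s, ↥(Y s)) :=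
    Cardinal.lt_aleph0_iff_finite.1 (hY.trans_lt Cardinal.natCast_lt_aleph0)
  choose m hm using fun p : Σ s, ↥(Y s) => Set.mem_iUnion.1 (hYX p.1 p.2.2)
  obtain ⟨M, hM⟩ := (Set.finite_range m).bddAbove
  refine Set.mem_iUnion.2 ⟨M + 1, apply_le_Jle_of_scard_le (fun t y hy => ?_) hY s hx⟩
  exact hmono (hM ⟨⟨t, y, hy⟩, rfl⟩) t (hm ⟨t, y, hy⟩)

theorem apply_le_Jlomega_of_scard_le {J : (∀ s, Set (α s)) → (∀ s, Set (α s))} {n : ℕ}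
    {Y : ∀ s, Set (α s)} (hY : scard Y ≤ n) : J Y ≤ Jlomega J n Y :=
  fun s _ hx => Set.mem_iUnion.2 ⟨1, apply_le_Jle_of_scard_le le_rfl hY s hx⟩

theorem Jlomega_mono (J : (∀ s, Set (α s)) → (∀ s, Set (α s))) {n : ℕ} (hJ : ∀ X, X ≤ J X)
    (hn : 1 ≤ n) : Monotone (Jlomega J n) :=
  fun _ Y hXY => Jlomega_le (hXY.trans (le_Jlomega J n Y)) (Jle_Jlomega_le hJ hn Y)

theorem isClosureOp_Jlomega {J : (∀ s, Set (α s)) → (∀ s, Set (α s))} (hJ : ∀ X, X ≤ J X)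
    {n : ℕ} (hn : 1 ≤ n) : IsClosureOp (Jlomega J n) :=
  ⟨le_Jlomega J n, fun _ _ h => Jlomega_mono J hJ hn h,
    fun X => (Jlomega_le le_rfl (Jle_Jlomega_le hJ hn X)).antisymm (le_Jlomega J n _)⟩

theorem isNary_Jlomega {J : (∀ s, Set (α s)) → (∀ s, Set (α s))} (hJ : ∀ X, X ≤ J X)
    {n : ℕ} (hn : 1 ≤ n) : IsNary n (Jlomega J n) := by
  funext X
  apply le_antisymm
  · refine Jlomega_le (le_Jlomega _ n X) (le_trans ?_ (Jle_Jlomega_le (le_Jlomega J n) hn X))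
    exact Jle_le_iff.2 fun Y hYX hY =>
      (apply_le_Jlomega_of_scard_le hY).trans (apply_le_Jle_of_scard_le hYX hY)
  · refine Jlomega_le (le_Jlomega J n X) (Jle_le_iff.2 fun Y hYX _ => ?_)
    exact Jlomega_le hYX (Jle_Jlomega_le hJ hn X)

end ManySorted

open ManySorted in
/-- For `n ≥ 1`, `J_{≤n}^ω` is the greatest `n`-ary many-sorted closure operator
smaller than or equal to `J`. -/
theorem statement_5 {S : Type u} {α : S → Type v} (n : ℕ) (hn : 1 ≤ n)
    (J : (∀ s, Set (α s)) → (∀ s, Set (α s))) (hJ : IsClosureOp J) :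
    IsClosureOp (Jlomega J n) ∧
    IsNary n (Jlomega J n) ∧
    (∀ (X : ∀ s, Set (α s)) (s : S), Jlomega J n X s ⊆ J X s) ∧
    (∀ K : (∀ s, Set (α s)) → (∀ s, Set (α s)), IsClosureOp K → IsNary n K →
      (∀ (X : ∀ s, Set (α s)) (s : S), K X s ⊆ J X s) →
      ∀ (X : ∀ s, Set (α s)) (s : S), K X s ⊆ Jlomega J n X s) := by
  obtain ⟨hext, hmono, hidem⟩ := hJ
  refine ⟨isClosureOp_Jlomega hext hn, isNary_Jlomega hext hn, fun X => ?_,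
    fun K _ hKn hKJ X => ?_⟩
  · refine Jlomega_le (hext X) (Jle_le_iff.2 fun Y hY _ => ?_)
    exact le_trans (hmono Y (J X) hY) (hidem X).le
  · rw [hKn]
    refine Jlomega_le (le_Jlomega J n X) (le_trans ?_ (Jle_Jlomega_le hext hn X))
    exact Jle_le_iff.2 fun Y hYX hY => le_trans (hKJ Y) (apply_le_Jle_of_scard_le hYX hY)
end

section
/- Let n be a natural number. If a many-sorted closure operator J on an S-sorted set A is n-ary, then J is algebraic, i.e., for every X ⊆ A, J(X) = ⋃_{K ⊆_fin X} J(K), the union being over all finite S-sorted subsets K of X. -/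
universe u v w

namespace ManySorted

variable {S : Type u} {α : S → Type v}

theorem scard_lt_aleph0_iff {X : ∀ s, Set (α s)} :
    scard X < Cardinal.aleph0 ↔ Finite (Σ s, ↥(X s)) :=
  Cardinal.lt_aleph0_iff_finite

theorem scard_delta_lt_aleph0 (t : S) (x : α t) : scard (delta t x) < Cardinal.aleph0 := by
  rw [scard_lt_aleph0_iff]
  have : Subsingleton (Σ s, ↥(delta t x s)) := by
    refine ⟨?_⟩
    rintro ⟨s, y, hy⟩ ⟨s', y', hy'⟩
    cases hy
    cases hy'
    rfl
  infer_instance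

theorem scard_iUnion_lt_aleph0 {ι : Type*} [Finite ι] {K : ι → ∀ s, Set (α s)}
    (hK : ∀ i, scard (K i) < Cardinal.aleph0) :
    scard (fun s => ⋃ i, K i s) < Cardinal.aleph0 := by
  rw [scard_lt_aleph0_iff]
  have : ∀ i, Finite (Σ s, ↥(K i s)) := fun i => scard_lt_aleph0_iff.1 (hK i)
  let f : (Σ i, Σ s, ↥(K i s)) → Σ s, ↥(⋃ i, K i s) := fun p =>
    ⟨p.2.1, p.2.2.1, Set.mem_iUnion.2 ⟨p.1, p.2.2.2⟩⟩
  refine Finite.of_surjective f ?_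
  rintro ⟨s, y, hy⟩
  obtain ⟨i, hi⟩ := Set.mem_iUnion.1 hy
  exact ⟨⟨i, s, y, hi⟩, rfl⟩

/-- Every element of an iterate `J_{≤n}^m X` lies in the closure of a finite subset of `X`. -/
theorem exists_finite_of_mem_JleIter {J : (∀ s, Set (α s)) → (∀ s, Set (α s))}
    (hJ : IsClosureOp J) (n m : ℕ) (X : ∀ s, Set (α s)) {s : S} {x : α s}
    (hx : x ∈ JleIter J n m X s) :
    ∃ K : ∀ s, Set (α s), ((∀ t, K t ⊆ X t) ∧ scard K < Cardinal.aleph0) ∧ x ∈ J K s := by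
  obtain ⟨hext, hmono, hidem⟩ := hJ
  induction m generalizing s x with
  | zero =>
    refine ⟨delta s x, ⟨?_, scard_delta_lt_aleph0 s x⟩, hext _ _ rfl⟩
    intro t y hy
    cases hy
    exact hx
  | succ m ih =>
    obtain ⟨Y, ⟨hYX, hY⟩, hxY⟩ : ∃ Y : ∀ s, Set (α s),
        ((∀ t, Y t ⊆ JleIter J n m X t) ∧ scard Y ≤ (n : Cardinal)) ∧ x ∈ J Y s := by
      simpa only [JleIter, Jle, Set.mem_iUnion, exists_prop] using hx
    have : Finite (Σ s, ↥(Y s)) :=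
      scard_lt_aleph0_iff.1 (hY.trans_lt Cardinal.natCast_lt_aleph0)
    choose K hK hmem using fun p : Σ s, ↥(Y s) => ih (hYX p.1 p.2.2)
    refine ⟨fun t => ⋃ p, K p t, ⟨fun t => Set.iUnion_subset fun p => (hK p).1 t,
      scard_iUnion_lt_aleph0 fun p => (hK p).2⟩, ?_⟩
    rw [← hidem]
    refine hmono Y _ (fun t y hy => ?_) s hxY
    exact hmono (K ⟨t, y, hy⟩) _ (fun r => Set.subset_iUnion (fun p => K p r) _) t
      (hmem ⟨t, y, hy⟩)

end ManySorted

open ManySorted in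
/-- If `J` is `n`-ary, then `J` is algebraic. -/
theorem statement_7 {S : Type u} {α : S → Type v} (n : ℕ)
    (J : (∀ s, Set (α s)) → (∀ s, Set (α s))) (hJ : IsClosureOp J)
    (hnary : IsNary n J) :
    Algebraic J := by
  intro X
  funext s
  refine Set.Subset.antisymm (fun x hx => ?_)
    (Set.iUnion₂_subset fun K hK => hJ.2.1 K X hK.1 s)
  rw [show J X = Jlomega J n X from congrFun hnary X] at hx
  obtain ⟨m, hm⟩ := Set.mem_iUnion.1 hx
  obtain ⟨K, hK, hxK⟩ := exists_finite_of_mem_JleIter hJ n m X hm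
  exact Set.mem_iUnion₂.2 ⟨K, hK, hxK⟩
end

section
/- Let Σ be an S-sorted signature, 𝐀 = (A, F) a Σ-algebra, and X, Y ⊆ A. Then: (1) if supp_S(X) = supp_S(Y), then for every n ∈ ℕ, supp_S(E_𝐀^n(X)) = supp_S(E_𝐀^n(Y)); (2) supp_S(Sg_𝐀(X)) = ⋃_{n∈ℕ} supp_S(E_𝐀^n(X)); (3) if supp_S(X) = supp_S(Y), then supp_S(Sg_𝐀(X)) = supp_S(Sg_𝐀(Y)); in particular, the algebraic many-sorted closure operator Sg_𝐀 is uniform. -/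
universe u v w

namespace ManySorted

variable {S : Type u} {α : S → Type v} {Sig : List S → S → Type w}
  {F : ∀ w s, Sig w s → ((∀ i : Fin w.length, α (w.get i)) → α s)} {X Y : ∀ s, Set (α s)}

theorem supp_Estep_subset (h : supp X ⊆ supp Y) :
    supp (Estep Sig F X) ⊆ supp (Estep Sig F Y) := by
  rintro s ⟨y, hy | ⟨w, σ, a, ha, -⟩⟩
  · exact (h ⟨y, hy⟩).mono Set.subset_union_left
  · have hb : ∀ i, ∃ b, b ∈ Y (w.get i) := fun i => h ⟨a i, ha i⟩
    choose b hb using hb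
    exact ⟨F w s σ b, Or.inr ⟨w, σ, b, hb, rfl⟩⟩

theorem supp_Eiter_subset (h : supp X ⊆ supp Y) (n : ℕ) :
    supp (Eiter Sig F n X) ⊆ supp (Eiter Sig F n Y) := by
  induction n with
  | zero => exact h
  | succ n ih => exact supp_Estep_subset ih

theorem supp_Eiter_congr (h : supp X = supp Y) (n : ℕ) :
    supp (Eiter Sig F n X) = supp (Eiter Sig F n Y) :=
  (supp_Eiter_subset h.subset n).antisymm (supp_Eiter_subset h.superset n)

theorem monotone_Eiter (s : S) : Monotone fun n => Eiter Sig F n X s :=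
  monotone_nat_of_le_succ fun _ => Set.subset_union_left

theorem closed_Eomega : Closed Sig F (Eomega Sig F X) := by
  intro w s σ a ha
  choose m hm using fun i => Set.mem_iUnion.1 (ha i)
  refine Set.mem_iUnion.2 ⟨Finset.univ.sup m + 1, Or.inr ⟨w, σ, a, fun i => ?_, rfl⟩⟩
  exact monotone_Eiter _ (Finset.le_sup (Finset.mem_univ i)) (hm i)

theorem Eiter_subset_of_closed (hY : Closed Sig F Y) (h : ∀ s, X s ⊆ Y s) (n : ℕ) (s : S) :
    Eiter Sig F n X s ⊆ Y s := by
  induction n generalizing s with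
  | zero => exact h s
  | succ n ih =>
    rintro _ (hy | ⟨w, σ, a, ha, rfl⟩)
    · exact ih s hy
    · exact hY w s σ a fun i => ih _ (ha i)

theorem Sg_eq_Eomega : Sg Sig F X = Eomega Sig F X := by
  funext s
  refine (Set.iInter₂_subset (Eomega Sig F X)
    ⟨closed_Eomega, fun t => Set.subset_iUnion (fun n => Eiter Sig F n X t) 0⟩).antisymm ?_
  exact Set.iUnion_subset fun n =>
    Set.subset_iInter₂ fun C hC => Eiter_subset_of_closed hC.1 hC.2 n s

theorem supp_Sg : supp (Sg Sig F X) = ⋃ n : ℕ, supp (Eiter Sig F n X) := by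
  ext s
  simp [Sg_eq_Eomega, supp, Eomega]

theorem uniform_Sg : Uniform (Sg Sig F) := fun X Y h => by
  simp only [supp_Sg, supp_Eiter_congr h]

end ManySorted

open ManySorted in
/-- Supports of the iterates of `E_𝐀` and of `Sg_𝐀`; in particular `Sg_𝐀` is uniform. -/
theorem statement_10 {S : Type u} {α : S → Type v}
    (Sig : List S → S → Type w)
    (F : ∀ w s, Sig w s → ((∀ i : Fin w.length, α (w.get i)) → α s))
    (X Y : ∀ s, Set (α s)) :
    ((supp X = supp Y → ∀ n : ℕ, supp (Eiter Sig F n X) = supp (Eiter Sig F n Y)) ∧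
     (supp (Sg Sig F X) = ⋃ n : ℕ, supp (Eiter Sig F n X)) ∧
     (supp X = supp Y → supp (Sg Sig F X) = supp (Sg Sig F Y))) ∧
    Uniform (Sg Sig F) :=
  ⟨⟨supp_Eiter_congr, supp_Sg, uniform_Sg X Y⟩, uniform_Sg⟩
end

section
/- If 𝐀 is a finitely generated Σ-algebra, then IrB(A, Sg_𝐀) is nonempty, i.e., the many-sorted closure space (A, Sg_𝐀) has an irredundant basis of finite cardinality. -/
universe u v w

namespace ManySorted

/-- `Sg` is contained in every closed family containing the generators. -/
lemma Sg_subset_of_closed {S : Type u} {α : S → Type v} {Sig : List S → S → Type w}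
    {F : ∀ w s, Sig w s → ((∀ i : Fin w.length, α (w.get i)) → α s)}
    {X C : ∀ s, Set (α s)} (hC : Closed Sig F C) (hXC : ∀ t, X t ⊆ C t) (s : S) :
    Sg Sig F X s ⊆ C s :=
  Set.iInter₂_subset C ⟨hC, hXC⟩

lemma subset_Sg {S : Type u} {α : S → Type v} (Sig : List S → S → Type w)
    (F : ∀ w s, Sig w s → ((∀ i : Fin w.length, α (w.get i)) → α s))
    (X : ∀ s, Set (α s)) (s : S) : X s ⊆ Sg Sig F X s :=
  Set.subset_iInter₂ fun _ hC => hC.2 s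

lemma closed_Sg {S : Type u} {α : S → Type v} (Sig : List S → S → Type w)
    (F : ∀ w s, Sig w s → ((∀ i : Fin w.length, α (w.get i)) → α s))
    (X : ∀ s, Set (α s)) : Closed Sig F (Sg Sig F X) :=
  fun w s σ a ha => Set.mem_iInter₂.2 fun _ hC =>
    hC.1 w s σ a fun i => Sg_subset_of_closed hC.1 hC.2 _ (ha i)

/-- Removing a redundant element from a basis leaves a basis. -/
lemma isBasis_diff_delta {S : Type u} {α : S → Type v} {Sig : List S → S → Type w}
    {F : ∀ w s, Sig w s → ((∀ i : Fin w.length, α (w.get i)) → α s)}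
    {X : ∀ s, Set (α s)} (hX : IsBasis (Sg Sig F) X) {s : S} {x : α s}
    (hx : x ∈ Sg Sig F (fun t => X t \ delta s x t) s) :
    IsBasis (Sg Sig F) (fun t => X t \ delta s x t) := by
  refine fun t => Set.univ_subset_iff.1 ((hX t).symm.subset.trans
    (Sg_subset_of_closed (closed_Sg Sig F _) (fun r y hy => ?_) t))
  by_cases hyx : y ∈ delta s x r
  · cases (show (⟨r, y⟩ : Σ s, α s) = ⟨s, x⟩ from hyx)
    exact hx
  · exact subset_Sg Sig F _ r ⟨hy, hyx⟩

/-- Removing an element from a finite sorted set strictly decreases its cardinal. -/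
lemma scard_diff_delta_lt {S : Type u} {α : S → Type v} {X : ∀ s, Set (α s)}
    (hfin : scard X < Cardinal.aleph0) {s : S} {x : α s} (hx : x ∈ X s) :
    scard (fun t => X t \ delta s x t) < scard X := by
  have : Finite (Σ t, X t) := Cardinal.lt_aleph0_iff_finite.1 hfin
  let f : (Σ t, ↥(X t \ delta s x t)) → Σ t, X t :=
    Sigma.map id fun _ => Set.inclusion Set.sdiff_subset
  have hf : Function.Injective f :=
    Function.injective_id.sigma_map fun _ => Set.inclusion_injective _
  refine (Cardinal.mk_le_of_injective hf).lt_of_not_ge fun hle => ?_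
  obtain ⟨g⟩ := hle
  have hsurj : Function.Surjective (f ∘ g) :=
    Finite.surjective_of_injective (hf.comp g.injective)
  obtain ⟨z, hz⟩ := hsurj ⟨s, x, hx⟩
  have hproj := congrArg (fun p : Σ t, X t => (⟨p.1, p.2⟩ : Σ t, α t)) hz
  exact (g z).2.2.2 hproj

end ManySorted

open ManySorted in
/-- If `𝐀` is finitely generated, then `IrB (A, Sg_𝐀)` is nonempty. -/
theorem statement_12 {S : Type u} {α : S → Type v}
    (Sig : List S → S → Type w)
    (F : ∀ w s, Sig w s → ((∀ i : Fin w.length, α (w.get i)) → α s))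
    (hfg : ∃ X : ∀ s, Set (α s), scard X < Cardinal.aleph0 ∧
      ∀ s, Sg Sig F X s = Set.univ) :
    (IrB (Sg Sig F)).Nonempty := by
  obtain ⟨X, ⟨hfin, hX⟩, hmin⟩ := (InvImage.wf scard Cardinal.lt_wf).has_min
    {X : ∀ s, Set (α s) | scard X < Cardinal.aleph0 ∧ IsBasis (Sg Sig F) X} hfg
  obtain ⟨n, hn⟩ := Cardinal.lt_aleph0.1 hfin
  refine ⟨n, X, fun s x hx hred => ?_, hX, hn⟩
  have hlt := scard_diff_delta_lt hfin hx
  exact hmin _ ⟨hlt.trans hfin, isBasis_diff_delta hX hred⟩ hlt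
end

section
/- Let J be an algebraic many-sorted closure operator on an S-sorted set A. If J is uniform, then there exist an S-sorted signature Σ and a Σ-algebra 𝐀 = (A, F) with underlying S-sorted set A such that J = Sg_𝐀. -/
universe u v w

namespace ManySorted

/-- The S-sorted set of the entries of a tuple. -/
def tupleRange {S : Type u} {α : S → Type v} {w : List S}
    (a : ∀ i : Fin w.length, α (w.get i)) : ∀ s, Set (α s) :=
  fun s => {y | ∃ i, (⟨w.get i, a i⟩ : Σ s, α s) = ⟨s, y⟩}

theorem tupleRange_subset {S : Type u} {α : S → Type v} {w : List S}
    {a : ∀ i : Fin w.length, α (w.get i)} {X : ∀ s, Set (α s)}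
    (h : ∀ i, a i ∈ X (w.get i)) (s : S) : tupleRange a s ⊆ X s := by
  rintro y ⟨i, hi⟩
  cases hi
  exact h i

theorem supp_tupleRange {S : Type u} {α : S → Type v} {w : List S}
    (a : ∀ i : Fin w.length, α (w.get i)) : supp (tupleRange a) = {s | s ∈ w} := by
  ext s
  constructor
  · rintro ⟨y, i, hi⟩
    cases hi
    exact List.get_mem w i
  · intro hs
    obtain ⟨i, rfl⟩ := List.get_of_mem hs
    exact ⟨a i, i, rfl⟩

theorem exists_tuple_of_list {S : Type u} {α : S → Type v} (l : List (Σ s, α s)) :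
    ∃ (w : List S) (a : ∀ i : Fin w.length, α (w.get i)),
      ∀ p, p ∈ l ↔ ∃ i, (⟨w.get i, a i⟩ : Σ s, α s) = p := by
  induction l with
  | nil => exact ⟨[], fun i => i.elim0, fun p => by simp⟩
  | cons q l ih =>
    obtain ⟨w, a, h⟩ := ih
    refine ⟨q.1 :: w, fun i => Fin.cases (motive := fun i => α ((q.1 :: w).get i)) q.2 a i,
      fun p => ?_⟩
    rw [List.mem_cons, h]
    constructor
    · rintro (rfl | ⟨i, rfl⟩)
      · exact ⟨(0 : Fin (w.length + 1)), rfl⟩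
      · exact ⟨Fin.succ i, rfl⟩
    · rintro ⟨i, rfl⟩
      refine Fin.cases (Or.inl rfl) (fun j => Or.inr ⟨j, rfl⟩) i

/-- A finite S-sorted set is the set of entries of a tuple. -/
theorem exists_tupleRange_eq {S : Type u} {α : S → Type v} {K : ∀ s, Set (α s)}
    (hK : scard K < Cardinal.aleph0) :
    ∃ (w : List S) (a : ∀ i : Fin w.length, α (w.get i)), tupleRange a = K := by
  have : Finite (Σ s, ↥(K s)) := Cardinal.lt_aleph0_iff_finite.mp hK
  let g : (Σ s, ↥(K s)) → Σ s, α s := fun p => ⟨p.1, p.2.1⟩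
  have hfin : (Set.range g).Finite := Set.finite_range g
  obtain ⟨w, a, h⟩ := exists_tuple_of_list hfin.toFinset.toList
  refine ⟨w, a, ?_⟩
  ext s y
  refine (h ⟨s, y⟩).symm.trans ?_
  rw [Finset.mem_toList, Set.Finite.mem_toFinset]
  constructor
  · rintro ⟨⟨t, z, hz⟩, hp⟩
    cases hp
    exact hz
  · intro hy
    exact ⟨⟨s, y, hy⟩, rfl⟩

end ManySorted

open ManySorted in
/-- If `J` is an algebraic and uniform many-sorted closure operator on `A`, then
`J = Sg_𝐀` for some S-sorted signature `Σ` and some `Σ`-algebra `𝐀` on `A`. -/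
theorem statement_13 {S : Type u} {α : S → Type v}
    (J : (∀ s, Set (α s)) → (∀ s, Set (α s))) (hJ : IsClosureOp J)
    (halg : Algebraic J) (huni : Uniform J) :
    ∃ (Sig : List S → S → Type (max u v))
      (F : ∀ w s, Sig w s → ((∀ i : Fin w.length, α (w.get i)) → α s)),
      J = Sg Sig F := by
  classical
  obtain ⟨hext, hmono, hidem⟩ := hJ
  refine ⟨fun w s => ULift.{u} {f : (∀ i : Fin w.length, α (w.get i)) → α s //
    ∀ a, f a ∈ J (tupleRange a) s}, fun w s σ => σ.down.1, ?_⟩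
  funext X s
  apply Set.Subset.antisymm
  · intro y hy
    simp only [Sg, Set.mem_iInter]
    rintro C ⟨hC, hXC⟩
    rw [halg X] at hy
    simp only [Set.mem_iUnion] at hy
    obtain ⟨K, ⟨hKX, hK⟩, hyK⟩ := hy
    obtain ⟨w, a, rfl⟩ := exists_tupleRange_eq hK
    have hne : ∀ b : ∀ i : Fin w.length, α (w.get i), (J (tupleRange b) s).Nonempty := by
      intro b
      have hs : s ∈ supp (J (tupleRange a)) := ⟨y, hyK⟩
      rwa [huni (tupleRange a) (tupleRange b)
        ((supp_tupleRange a).trans (supp_tupleRange b).symm)] at hs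
    choose f hf using hne
    have hupd : ∀ b, Function.update f a y b ∈ J (tupleRange b) s := by
      intro b
      by_cases hb : b = a
      · subst hb
        simpa using hyK
      · simpa [hb] using hf b
    have := hC w s ⟨⟨Function.update f a y, hupd⟩⟩ a
      fun i => hXC _ (hKX _ ⟨i, rfl⟩)
    simpa using this
  · refine Set.iInter₂_subset (J X) ⟨?_, hext X⟩
    intro w t σ a ha
    have := hmono _ _ (tupleRange_subset ha) t (σ.down.2 a)
    rwa [hidem] at this
end

section
/- Tarski's irredundant basis theorem for many-sorted closure spaces: Let (A, J) be a many-sorted closure space such that J is an n-ary many-sorted closure operator on the S-sorted set A with n ≥ 2. If i < j with i, j ∈ IrB(A, J) and {i+1, …, j−1} ∩ IrB(A, J) = ∅, then j − i ≤ n − 1. In particular, if n = 2, then IrB(A, J) is a convex subset of ℕ. -/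
universe u v w

namespace ManySorted

section SingleSorted

variable {T : Type*}

/-- A finite set is an irredundant basis of the (single-sorted) closure operator `c`. -/
def IsFinIrredundantBasis [DecidableEq T] (c : ClosureOperator (Set T)) (F : Finset T) : Prop :=
  c F = Set.univ ∧ ∀ x ∈ F, x ∉ c (F.erase x : Finset T)

/-- If `a` lies in the closure of `D`, then `D` spans as soon as `insert a D` does. -/
lemma closure_eq_univ_of_subset_insert {c : ClosureOperator (Set T)} {C D : Set T} {a : T}
    (hC : c C = Set.univ) (hCD : C ⊆ insert a D) (ha : a ∈ c D) : c D = Set.univ := by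
  have h : C ⊆ c D := hCD.trans (Set.insert_subset ha (c.le_closure D))
  have hle : c C ≤ c D := c.closure_min h (c.isClosed_closure D)
  rw [hC] at hle
  exact Set.univ_subset_iff.1 hle

/-- Every finite spanning set contains an irredundant basis. -/
lemma exists_subset_isFinIrredundantBasis [DecidableEq T] (c : ClosureOperator (Set T)) (F : Finset T)
    (hF : c F = Set.univ) : ∃ G ⊆ F, IsFinIrredundantBasis c G := by
  induction F using Finset.strongInduction with
  | H F ih =>
    by_cases h : ∀ x ∈ F, x ∉ c (F.erase x : Finset T)
    · exact ⟨F, subset_rfl, hF, h⟩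
    · push Not at h
      obtain ⟨x, hx, hxc⟩ := h
      have hspan : c (F.erase x : Finset T) = Set.univ :=
        closure_eq_univ_of_subset_insert hF
          (by rw [← Finset.coe_insert, Finset.insert_erase hx]) hxc
      obtain ⟨G, hG, hGb⟩ := ih _ (Finset.erase_ssubset hx) hspan
      exact ⟨G, hG.trans (Finset.erase_subset _ _), hGb⟩

/-- An irredundant basis is a minimal spanning set. -/
lemma IsFinIrredundantBasis.eq_of_subset [DecidableEq T] {c : ClosureOperator (Set T)} {F G : Finset T}
    (hF : IsFinIrredundantBasis c F) (hG : c G = Set.univ) (hGF : G ⊆ F) : G = F := by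
  refine hGF.antisymm fun x hx => ?_
  by_contra hxG
  have hsub : (G : Set T) ⊆ (F.erase x : Finset T) :=
    Finset.coe_subset.2 (Finset.subset_erase.2 ⟨hGF, hxG⟩)
  have hmem : x ∈ c G := hG ▸ Set.mem_univ x
  exact hF.2 x hx (c.monotone hsub hmem)

/-- Tarski's exchange argument: if every element of `L (m + 1)` is in the closure of at most `n`
elements of `L m`, and no irredundant basis has cardinality strictly between `i` and
`j ≥ i + n`, then, starting from an irredundant basis `L 0` of cardinality greater than `i`, every
finite spanning set contained in a level has cardinality greater than `i`. -/
lemma lt_card_of_subset_level [DecidableEq T] (c : ClosureOperator (Set T)) (L : ℕ → Set T)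
    {n i j : ℕ}
    (hL : ∀ m, ∀ a ∈ L (m + 1), ∃ Y : Finset T, ↑Y ⊆ L m ∧ Y.card ≤ n ∧ a ∈ c Y)
    (hmono : ∀ m, L m ⊆ L (m + 1)) {B : Finset T} (hB : IsFinIrredundantBasis c B)
    (hB0 : L 0 = B) (hiB : i < B.card) (hij : i + n ≤ j)
    (hgap : ∀ G, IsFinIrredundantBasis c G → i < G.card → j ≤ G.card) (m : ℕ) :
    ∀ A : Finset T, ↑A ⊆ L m → c A = Set.univ → i < A.card := by
  classical
  induction m with
  | zero =>
    intro A hA hspan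
    rw [hB0, Finset.coe_subset] at hA
    rwa [hB.eq_of_subset hspan hA]
  | succ m ihm =>
    intro A
    induction hr : (A.filter (· ∉ L m)).card using Nat.strong_induction_on generalizing A with
    | _ r ih =>
      intro hA hspan
      by_cases hAm : ↑A ⊆ L m
      · exact ihm A hAm hspan
      obtain ⟨a, haA, ham⟩ := Set.not_subset.1 hAm
      obtain ⟨Y, hYm, hYn, haY⟩ := hL m a (hA haA)
      have haA' : a ∈ A := haA
      have hspan' : c (A.erase a ∪ Y : Finset T) = Set.univ := by
        refine closure_eq_univ_of_subset_insert (a := a) hspan (fun x hx => ?_)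
          (c.monotone (Finset.coe_subset.2 Finset.subset_union_right) haY)
        by_cases hxa : x = a
        · exact Or.inl hxa
        · exact Or.inr (by simp [hxa, Finset.mem_coe.1 hx])
      obtain ⟨G, hGsub, hG⟩ := exists_subset_isFinIrredundantBasis c _ hspan'
      have hlevel : G.filter (· ∉ L m) ⊂ A.filter (· ∉ L m) := by
        refine (Finset.ssubset_iff_of_subset fun x hx => ?_).2
          ⟨a, by simp [haA', ham], fun h => ?_⟩
        · obtain ⟨hxG, hxm⟩ := Finset.mem_filter.1 hx
          rcases Finset.mem_union.1 (hGsub hxG) with h | h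
          · exact Finset.mem_filter.2 ⟨Finset.mem_of_mem_erase h, hxm⟩
          · exact absurd (hYm h) hxm
        · rcases Finset.mem_union.1 (hGsub (Finset.mem_filter.1 h).1) with h | h
          · exact Finset.notMem_erase a A h
          · exact ham (hYm h)
      have hGm : ↑G ⊆ L (m + 1) := fun x hx => by
        rcases Finset.mem_union.1 (hGsub hx) with h | h
        · exact hA (Finset.mem_of_mem_erase h)
        · exact hmono m (hYm h)
      have hjG := hgap G hG (ih _ (hr ▸ Finset.card_lt_card hlevel) G rfl hGm hG.1)
      have hle := (Finset.card_le_card hGsub).trans (Finset.card_union_le _ _)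
      have herase := Finset.card_erase_add_one haA'
      omega

end SingleSorted

section Total

variable {S : Type u} {α : S → Type v}

/-- The set of elements of the coproduct of an `S`-sorted set. -/
def total (X : ∀ s, Set (α s)) : Set (Σ s, α s) := {p | p.2 ∈ X p.1}

/-- The `S`-sorted set of fibres of a subset of the coproduct. -/
def fibres (X : Set (Σ s, α s)) : ∀ s, Set (α s) := fun s => {y | ⟨s, y⟩ ∈ X}

@[simp] lemma fibres_total (X : ∀ s, Set (α s)) : fibres (total X) = X := rfl

@[simp] lemma total_fibres (X : Set (Σ s, α s)) : total (fibres X) = X := rfl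

lemma mk_total (X : ∀ s, Set (α s)) : Cardinal.mk (total X) = scard X :=
  Cardinal.mk_congr
    { toFun := fun p => ⟨p.1.1, p.1.2, p.2⟩
      invFun := fun q => ⟨⟨q.1, q.2.1⟩, q.2.2⟩
      left_inv := fun _ => rfl
      right_inv := fun _ => rfl }

/-- The closure operator on the coproduct induced by a many-sorted closure operator. -/
def totalClosure (J : (∀ s, Set (α s)) → (∀ s, Set (α s))) (hJ : IsClosureOp J) :
    ClosureOperator (Set (Σ s, α s)) where
  toFun X := total (J (fibres X))
  monotone' _ _ h p hp := hJ.2.1 _ _ (fun _ _ hy => h hy) p.1 hp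
  le_closure' X p hp := hJ.1 (fibres X) p.1 hp
  idempotent' X := by simp [hJ.2.2]

variable {J : (∀ s, Set (α s)) → (∀ s, Set (α s))}

lemma totalClosure_apply (hJ : IsClosureOp J) (X : Set (Σ s, α s)) :
    totalClosure J hJ X = total (J (fibres X)) := rfl

lemma isBasis_fibres_iff (hJ : IsClosureOp J) (X : Set (Σ s, α s)) :
    IsBasis J (fibres X) ↔ totalClosure J hJ X = Set.univ := by
  rw [totalClosure_apply, Set.eq_univ_iff_forall]
  exact ⟨fun h p => by simp [total, h p.1],
    fun h s => Set.eq_univ_iff_forall.2 fun y => h ⟨s, y⟩⟩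

lemma irredundant_fibres_iff [DecidableEq (Σ s, α s)] (hJ : IsClosureOp J) (F : Finset (Σ s, α s)) :
    Irredundant J (fibres (F : Set (Σ s, α s))) ↔
      ∀ x ∈ F, x ∉ totalClosure J hJ (F.erase x : Finset _) := by
  have key (x : Σ s, α s) : (fun t => fibres (F : Set (Σ s, α s)) t \ delta x.1 x.2 t) =
      fibres ((F.erase x : Finset _) : Set (Σ s, α s)) := by
    funext t
    ext y
    simp [fibres, delta, and_comm]
  constructor
  · intro h x hx hxc
    refine h x.1 x.2 hx ?_
    rw [key x]
    exact hxc
  · intro h s y hy hyc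
    refine h ⟨s, y⟩ hy ?_
    rw [key ⟨s, y⟩] at hyc
    exact hyc

lemma mem_IrB_iff [DecidableEq (Σ s, α s)] (hJ : IsClosureOp J) (k : ℕ) :
    k ∈ IrB J ↔ ∃ F, IsFinIrredundantBasis (totalClosure J hJ) F ∧ F.card = k := by
  constructor
  · rintro ⟨X, hirr, hbas, hcard⟩
    rw [← mk_total, Cardinal.mk_set_eq_nat_iff_finset] at hcard
    obtain ⟨F, hF, hk⟩ := hcard
    obtain rfl : fibres (F : Set (Σ s, α s)) = X := by rw [hF, fibres_total]
    exact ⟨F, ⟨(isBasis_fibres_iff hJ _).1 hbas, (irredundant_fibres_iff hJ F).1 hirr⟩, hk⟩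
  · rintro ⟨F, ⟨hspan, hirr⟩, hk⟩
    refine ⟨fibres (F : Set (Σ s, α s)), (irredundant_fibres_iff hJ F).2 hirr,
      (isBasis_fibres_iff hJ _).2 hspan, ?_⟩
    rw [← mk_total, total_fibres, Cardinal.mk_set_eq_nat_iff_finset]
    exact ⟨F, rfl, hk⟩

lemma exists_finset_of_mem_JleIter_succ (hJ : IsClosureOp J) {n m : ℕ} {X : ∀ s, Set (α s)}
    {a : Σ s, α s}
    (ha : a ∈ total (JleIter J n (m + 1) X)) :
    ∃ Y : Finset (Σ s, α s), ↑Y ⊆ total (JleIter J n m X) ∧ Y.card ≤ n ∧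
      a ∈ totalClosure J hJ Y := by
  obtain ⟨Z, ⟨hZ, hcard⟩, haZ⟩ := by
    simpa only [total, JleIter, Jle, Set.mem_iUnion, Set.mem_ofPred_eq, exists_prop] using ha
  obtain ⟨k, hk⟩ := Cardinal.lt_aleph0.1 (hcard.trans_lt (Cardinal.natCast_lt_aleph0 (n := n)))
  rw [hk, Nat.cast_le] at hcard
  rw [← mk_total, Cardinal.mk_set_eq_nat_iff_finset] at hk
  obtain ⟨Y, hY, rfl⟩ := hk
  refine ⟨Y, fun p hp => ?_, hcard, ?_⟩
  · rw [hY] at hp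
    exact hZ p.1 hp
  · rw [hY]
    exact haZ

lemma total_JleIter_subset_succ (hJ : IsClosureOp J) {n : ℕ} (hn : 1 ≤ n) (m : ℕ)
    (X : ∀ s, Set (α s)) :
    total (JleIter J n m X) ⊆ total (JleIter J n (m + 1) X) := by
  intro p hp
  simp only [total, JleIter, Jle, Set.mem_iUnion, Set.mem_ofPred_eq, exists_prop]
  refine ⟨fibres {p}, ⟨fun t y hy => ?_, ?_⟩, hJ.1 (fibres {p}) p.1 rfl⟩
  · obtain rfl : (⟨t, y⟩ : Σ s, α s) = p := hy
    exact hp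
  · rw [← mk_total, total_fibres, Cardinal.mk_singleton]
    exact_mod_cast hn

/-- Gaps in `IrB J` are bounded by the arity. -/
lemma sub_le_of_gap (hJ : IsClosureOp J) {n : ℕ} (hn : 1 ≤ n) (hnary : IsNary n J) {i j : ℕ}
    (hi : i ∈ IrB J) (hj : j ∈ IrB J) (hij : i < j) (hgap : ∀ k, i < k → k < j → k ∉ IrB J) :
    j - i ≤ n - 1 := by
  classical
  by_contra hlt
  obtain ⟨A, hA, hAi⟩ := (mem_IrB_iff hJ i).1 hi
  obtain ⟨B, hB, hBj⟩ := (mem_IrB_iff hJ j).1 hj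
  let L : ℕ → Set (Σ s, α s) := fun m => total (JleIter J n m (fibres (B : Set (Σ s, α s))))
  have hmono : ∀ m, L m ⊆ L (m + 1) := fun m => total_JleIter_subset_succ hJ hn m _
  have hcover : (A : Set (Σ s, α s)) ⊆ ⋃ m, L m := by
    intro p _
    have hp : p ∈ total (J (fibres (B : Set (Σ s, α s)))) := by
      rw [← totalClosure_apply hJ, hB.1]
      trivial
    rw [hnary] at hp
    simpa only [total, Jlomega, Set.mem_iUnion, Set.mem_ofPred_eq, L] using hp
  obtain ⟨m, hm⟩ := (monotone_nat_of_le_succ hmono).directed_le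
    |>.exists_mem_subset_of_finset_subset_biUnion hcover
  have hcard := lt_card_of_subset_level (totalClosure J hJ) L (n := n) (i := i) (j := j)
    (fun m a ha => exists_finset_of_mem_JleIter_succ hJ ha) hmono hB rfl (by omega) (by omega)
    (fun G hG hiG => by
      by_contra hGj
      exact hgap G.card hiG (by omega) ((mem_IrB_iff hJ _).2 ⟨G, hG, rfl⟩)) m A hm hA.1
  omega

end Total

/-- A set of naturals whose consecutive elements differ by one is convex. -/
lemma mem_of_forall_gap_le_one {C : Set ℕ}
    (hC : ∀ i j, i ∈ C → j ∈ C → i < j → (∀ k, i < k → k < j → k ∉ C) → j - i ≤ 1)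
    {i j k : ℕ} (hi : i ∈ C) (hj : j ∈ C) (hik : i ≤ k) (hkj : k ≤ j) : k ∈ C := by
  classical
  by_contra hk
  have hex : ∃ b, b ∈ C ∧ k ≤ b := ⟨j, hj, hkj⟩
  obtain ⟨hbC, hkb⟩ := Nat.find_spec hex
  have haC : Nat.findGreatest (· ∈ C) k ∈ C := Nat.findGreatest_spec (P := (· ∈ C)) hik hi
  have hak : Nat.findGreatest (· ∈ C) k ≤ k := Nat.findGreatest_le k
  have hak' : Nat.findGreatest (· ∈ C) k ≠ k := fun h => hk (h ▸ haC)
  have hkb' : Nat.find hex ≠ k := fun h => hk (h ▸ hbC)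
  have := hC _ _ haC hbC (by omega) fun l hal hlb hl => by
    rcases le_total l k with h | h
    · exact Nat.findGreatest_is_greatest hal h hl
    · exact Nat.find_min hex hlb ⟨hl, h⟩
  omega

end ManySorted

open ManySorted in
/-- Tarski's irredundant basis theorem for many-sorted closure spaces: if `J` is
`n`-ary with `n ≥ 2`, the gaps of `IrB (A, J)` have length at most `n - 2`; in
particular, for `n = 2`, `IrB (A, J)` is convex. -/
theorem statement_18 {S : Type u} {α : S → Type v}
    (J : (∀ s, Set (α s)) → (∀ s, Set (α s))) (hJ : IsClosureOp J)
    (n : ℕ) (hn : 2 ≤ n) (hnary : IsNary n J) :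
    (∀ i j : ℕ, i ∈ IrB J → j ∈ IrB J → i < j →
      (∀ k, i < k → k < j → k ∉ IrB J) → j - i ≤ n - 1) ∧
    (n = 2 → ∀ i j k : ℕ, i ∈ IrB J → j ∈ IrB J → i ≤ k → k ≤ j → k ∈ IrB J) := by
  have hgap : ∀ i j : ℕ, i ∈ IrB J → j ∈ IrB J → i < j →
      (∀ k, i < k → k < j → k ∉ IrB J) → j - i ≤ n - 1 :=
    fun _ _ hi hj hij h => sub_le_of_gap hJ (by omega) hnary hi hj hij h
  refine ⟨hgap, ?_⟩
  rintro rfl i j k hi hj hik hkj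
  exact mem_of_forall_gap_le_one hgap hi hj hik hkj
end
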